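/- arXiv:1504.06762 — 3 statements merged into one kernel-verified Lean document; each statement's English description precedes it below -/
import Mathlib

section
/- The canonical data (π_c, S, T, W) is a homomorphism dilation system of the linear system (φ, A, V): π_c is a well-defined unital algebra homomorphism A → L(W), T is injective, S is surjective, and S ∘ π_c(a) ∘ T = φ(a) for every a ∈ A. -/
open scoped TensorProduct

variable (k : Type*) [Field k] (A : Type*) [Ring A] [Algebra k A]
  (V : Type*) [AddCommGroup V] [Module k V]

/-- `α_{a,x}(b) = φ(b a) x`. -/
def alpha (φ : A →ₗ[k] Module.End k V) (a : A) (x : V) : A →ₗ[k] V where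
  toFun b := φ (b * a) x
  map_add' b c := by simp [add_mul]
  map_smul' c b := by simp [smul_mul_assoc]

/-- The canonical dilation space `W_c = span{α_{a,x}}`. -/
def Wc (φ : A →ₗ[k] Module.End k V) : Submodule k (A →ₗ[k] V) :=
  Submodule.span k {f : A →ₗ[k] V | ∃ (a : A) (x : V), f = alpha k A V φ a x}

/-- Precomposition by right multiplication; the ambient form of `π_c`. -/
def Gamma (a : A) : (A →ₗ[k] V) →ₗ[k] (A →ₗ[k] V) where
  toFun f := f ∘ₗ LinearMap.mulRight k a
  map_add' f g := by ext b; simp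
  map_smul' c f := by ext b; simp

theorem gamma_alpha (φ : A →ₗ[k] Module.End k V) (a b : A) (x : V) :
    Gamma k A V a (alpha k A V φ b x) = alpha k A V φ (a * b) x := by
  ext c; simp [Gamma, alpha, mul_assoc]

theorem gamma_mem (φ : A →ₗ[k] Module.End k V) (a : A) {f : A →ₗ[k] V}
    (hf : f ∈ Wc k A V φ) : Gamma k A V a f ∈ Wc k A V φ := by
  have h : (Wc k A V φ).map (Gamma k A V a) ≤ Wc k A V φ := by
    rw [Wc, Submodule.map_span, Submodule.span_le]
    rintro _ ⟨g, ⟨b, x, rfl⟩, rfl⟩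
    exact Submodule.subset_span ⟨a * b, x, gamma_alpha k A V φ a b x⟩
  exact h ⟨f, hf, rfl⟩

/-- The canonical homomorphism `π_c(a)` on `W_c`. -/
def piC (φ : A →ₗ[k] Module.End k V) (a : A) : ↥(Wc k A V φ) →ₗ[k] ↥(Wc k A V φ) :=
  (Gamma k A V a).restrict fun _ hf => gamma_mem k A V φ a hf

/-- The canonical synthesis operator `S(α_{a,x}) = φ(a)x` (evaluation at `1`). -/
def Sc (φ : A →ₗ[k] Module.End k V) : ↥(Wc k A V φ) →ₗ[k] V :=
  (LinearMap.applyₗ (1 : A)).comp (Wc k A V φ).subtype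

/-- The canonical analysis operator `T(x) = α_{1,x}`. -/
def Tc (φ : A →ₗ[k] Module.End k V) : V →ₗ[k] ↥(Wc k A V φ) where
  toFun x := ⟨alpha k A V φ 1 x, Submodule.subset_span ⟨1, x, rfl⟩⟩
  map_add' x y := Subtype.ext (by ext b; simp [alpha])
  map_smul' c x := Subtype.ext (by ext b; simp [alpha])

/-- the canonical data is a homomorphism dilation system of `(φ, A, V)`:
there is a (well-defined) unital algebra homomorphism `π_c : A → L(W_c)` with
`π_c(a) α_{b,x} = α_{ab,x}`, `T` is injective, `S` is surjective, and
`S ∘ π_c(a) ∘ T = φ(a)` for every `a ∈ A`. -/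
theorem canonical_is_dilation_system [Nontrivial V]
    (φ : A →ₗ[k] Module.End k V) (hφ : φ 1 = 1) :
    ∃ πc : A →ₐ[k] Module.End k ↥(Wc k A V φ),
      (∀ (a b : A) (x : V),
        (πc a ⟨alpha k A V φ b x, Submodule.subset_span ⟨b, x, rfl⟩⟩ : A →ₗ[k] V) =
          alpha k A V φ (a * b) x) ∧
      Function.Injective (Tc k A V φ) ∧
      Function.Surjective (Sc k A V φ) ∧
      ∀ a : A, (Sc k A V φ) ∘ₗ (πc a : ↥(Wc k A V φ) →ₗ[k] ↥(Wc k A V φ)) ∘ₗ Tc k A V φ =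
        (φ a : V →ₗ[k] V) := by
  have hS : ∀ x : V, Sc k A V φ (Tc k A V φ x) = x := by
    intro x
    change φ (1 * 1) x = x
    rw [mul_one, hφ]
    rfl
  refine ⟨AlgHom.ofLinearMap
    { toFun := fun a => (piC k A V φ a : Module.End k ↥(Wc k A V φ))
      map_add' := ?_
      map_smul' := ?_ } ?_ ?_, ?_, ?_, ?_, ?_⟩
  · intro a b
    ext f c
    change (f : A →ₗ[k] V) (c * (a + b)) =
      (f : A →ₗ[k] V) (c * a) + (f : A →ₗ[k] V) (c * b)
    rw [mul_add, map_add]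
  · intro r a
    ext f c
    change (f : A →ₗ[k] V) (c * (r • a)) = r • (f : A →ₗ[k] V) (c * a)
    rw [mul_smul_comm, map_smul]
  · ext f c
    change (f : A →ₗ[k] V) (c * 1) = (f : A →ₗ[k] V) c
    rw [mul_one]
  · intro a b
    ext f c
    change (f : A →ₗ[k] V) (c * (a * b)) = (f : A →ₗ[k] V) (c * a * b)
    rw [mul_assoc]
  · intro a b x
    exact gamma_alpha k A V φ a b x
  · exact Function.LeftInverse.injective hS
  · exact Function.RightInverse.surjective hS
  · intro a
    ext x
    change φ (1 * a * 1) x = φ a x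
    rw [one_mul, mul_one]
end

section
/- A finite-dimensional linearly minimal dilation system equivalent to the canonical dilation is irreducible: if (π₁, S₁, T₁, W₁) is a linearly minimal dilation system of (φ, A, V) with dim W₁ < ∞ and π₁ is equivalent (as a dilation system) to the canonical dilation, then ker S₁ contains no nonzero π₁-invariant subspace. -/
open scoped TensorProduct

variable (k : Type*) [Field k] (A : Type*) [Ring A] [Algebra k A]
  (V : Type*) [AddCommGroup V] [Module k V]

/-- a finite-dimensional linearly minimal dilation system that is
equivalent (as a dilation system) to the canonical dilation is irreducible. -/
theorem equivalent_to_canonical_implies_irreducible (φ : A →ₗ[k] Module.End k V)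
    (hφ : φ 1 = 1)
    (W₁ : Type*) [AddCommGroup W₁] [Module k W₁] [FiniteDimensional k W₁]
    (π₁ : A →ₐ[k] Module.End k W₁) (T₁ : V →ₗ[k] W₁) (S₁ : W₁ →ₗ[k] V)
    (hT₁ : Function.Injective T₁) (hS₁ : Function.Surjective S₁)
    (hdil₁ : ∀ a : A, (φ a : V →ₗ[k] V) = S₁ ∘ₗ (π₁ a : W₁ →ₗ[k] W₁) ∘ₗ T₁)
    (hmin₁ : Submodule.span k {w : W₁ | ∃ (a : A) (x : V), w = π₁ a (T₁ x)} = ⊤)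
    (R : W₁ ≃ₗ[k] ↥(Wc k A V φ))
    (hRT : ∀ x : V, R (T₁ x) = Tc k A V φ x)
    (hRS : ∀ w : W₁, Sc k A V φ (R w) = S₁ w)
    (hRπ : ∀ (a : A) (w : W₁), R (π₁ a w) = piC k A V φ a (R w)) :
    ∀ K : Submodule k W₁, (∀ a : A, K.map (π₁ a : W₁ →ₗ[k] W₁) ≤ K) →
      K ≤ LinearMap.ker S₁ → K = ⊥ := by
  intro K hK hker
  rw [Submodule.eq_bot_iff]
  intro w hw
  apply R.injective
  rw [map_zero]
  apply Subtype.ext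
  apply LinearMap.ext
  intro a
  have h1 : S₁ (π₁ a w) = 0 := hker (hK a ⟨w, hw, rfl⟩)
  rw [← hRS, hRπ] at h1
  have h2 : (R w : A →ₗ[k] V) (1 * a) = 0 := h1
  rw [one_mul] at h2
  exact h2
end

section
/- For V one-dimensional (so φ : A → k a unital linear functional), the universal and principle dilations of (φ, A, V) are equivalent if and only if ker φ contains no nonzero left ideal of A; equivalently, M = { a ∈ A : φ(ba) = 0 for all b ∈ A } = {0}. -/
variable (k : Type*) [Field k] (A : Type*) [Ring A] [Algebra k A]

/-- For a linear functional `φ : A → k`, the canonical-dilation generator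
`α_{a,x}(b) = φ(b a) x` (here `x ∈ k`, so `V = k` is one-dimensional). -/
def alphaF (φ : A →ₗ[k] k) (a : A) (x : k) : A →ₗ[k] k :=
  x • (φ ∘ₗ LinearMap.mulRight k a)

/-- The canonical dilation space of `(φ, A, k)`. -/
def WcF (φ : A →ₗ[k] k) : Submodule k (A →ₗ[k] k) :=
  Submodule.span k {f : A →ₗ[k] k | ∃ (a : A) (x : k), f = alphaF k A φ a x}

/-- Precomposition with right multiplication, the ambient form of `π_c`. -/
def GammaF (a : A) : (A →ₗ[k] k) →ₗ[k] (A →ₗ[k] k) where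
  toFun f := f ∘ₗ LinearMap.mulRight k a
  map_add' f g := by ext b; simp
  map_smul' c f := by ext b; simp

theorem gammaF_alphaF (φ : A →ₗ[k] k) (a b : A) (x : k) :
    GammaF k A a (alphaF k A φ b x) = alphaF k A φ (a * b) x := by
  ext c; simp [GammaF, alphaF, mul_assoc]

theorem gammaF_mem (φ : A →ₗ[k] k) (a : A) {f : A →ₗ[k] k}
    (hf : f ∈ WcF k A φ) : GammaF k A a f ∈ WcF k A φ := by
  have h : (WcF k A φ).map (GammaF k A a) ≤ WcF k A φ := by
    rw [WcF, Submodule.map_span, Submodule.span_le]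
    rintro _ ⟨g, ⟨b, x, rfl⟩, rfl⟩
    exact Submodule.subset_span ⟨a * b, x, gammaF_alphaF k A φ a b x⟩
  exact h ⟨f, hf, rfl⟩

/-- The canonical (principle) homomorphism `π_c(a)` on `W_c`. -/
def piCF (φ : A →ₗ[k] k) (a : A) : ↥(WcF k A φ) →ₗ[k] ↥(WcF k A φ) :=
  (GammaF k A a).restrict fun _ hf => gammaF_mem k A φ a hf

/-- The canonical synthesis operator (evaluation at `1`), `S_c(α_{a,x}) = φ(a) x`. -/
def ScF (φ : A →ₗ[k] k) : ↥(WcF k A φ) →ₗ[k] k :=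
  (LinearMap.applyₗ (1 : A)).comp (WcF k A φ).subtype

/-- The canonical analysis operator `T_c(c) = α_{1,c}`. -/
def TcF (φ : A →ₗ[k] k) : k →ₗ[k] ↥(WcF k A φ) where
  toFun c := ⟨alphaF k A φ 1 c, Submodule.subset_span ⟨1, c, rfl⟩⟩
  map_add' x y := Subtype.ext (by ext b; simp [alphaF, add_smul])
  map_smul' c x := Subtype.ext (by ext b; simp [alphaF, mul_smul])

/-- for `V = k` one-dimensional (so `φ : A → k` a unital linear
functional), the universal dilation (on `A ⊗ k ≅ A`: `π_u(a)b = ab`, `S = φ`,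
`T(c) = c·1`) and the principle (canonical) dilation of `(φ, A, k)` are equivalent if
and only if `ker φ` contains no nonzero left ideal of `A`; equivalently,
`M = {a ∈ A : φ(ba) = 0 for all b ∈ A} = {0}`. -/
theorem universal_equiv_principle_iff_no_left_ideal
    (φ : A →ₗ[k] k) (hφ : φ 1 = 1) :
    ((∃ R : A ≃ₗ[k] ↥(WcF k A φ),
        (∀ c : k, R (c • (1 : A)) = TcF k A φ c) ∧
        (∀ a : A, ScF k A φ (R a) = φ a) ∧
        (∀ a b : A, R (a * b) = piCF k A φ a (R b))) ↔
      ∀ J : Ideal A, (∀ a ∈ J, φ a = 0) → J = ⊥) ∧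
    ((∀ J : Ideal A, (∀ a ∈ J, φ a = 0) → J = ⊥) ↔
      ∀ a : A, (∀ b : A, φ (b * a) = 0) → a = 0) := by
  have h2 : (∀ J : Ideal A, (∀ a ∈ J, φ a = 0) → J = ⊥) ↔
      ∀ a : A, (∀ b : A, φ (b * a) = 0) → a = 0 := by
    constructor
    · intro h a ha
      have hJ := h (Ideal.span {a}) (by
        intro x hx
        obtain ⟨b, rfl⟩ := Ideal.mem_span_singleton'.1 hx
        exact ha b)
      exact Ideal.span_singleton_eq_bot.1 hJ
    · intro h J hJ
      rw [eq_bot_iff]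
      intro a ha
      exact h a fun b => hJ _ (J.mul_mem_left b ha)
  refine ⟨?_, h2⟩
  rw [h2]
  constructor
  · rintro ⟨R, -, hS, hP⟩ a ha
    apply R.map_eq_zero_iff.1
    apply Subtype.ext
    ext b
    have h := hS (b * a)
    rw [hP, ha b] at h
    simpa [ScF, piCF, GammaF] using h
  · intro h
    let L : A →ₗ[k] ↥(WcF k A φ) :=
      { toFun := fun a => ⟨alphaF k A φ a 1, Submodule.subset_span ⟨a, 1, rfl⟩⟩
        map_add' := fun x y => Subtype.ext (by ext b; simp [alphaF, mul_add])
        map_smul' := fun c x => Subtype.ext (by ext b; simp [alphaF]) }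
    have hL : ∀ a b, (L a).1 b = φ (b * a) := fun a b => by simp [L, alphaF]
    have hinj : Function.Injective L := by
      rw [injective_iff_map_eq_zero]
      intro a ha
      refine h a fun b => ?_
      rw [← hL, ha]; rfl
    have hsurj : Function.Surjective L := by
      have key : WcF k A φ ≤ (LinearMap.range L).map (WcF k A φ).subtype := by
        refine Submodule.span_le.2 ?_
        rintro _ ⟨a, x, rfl⟩
        refine ⟨L (x • a), ⟨_, rfl⟩, ?_⟩
        ext b
        simp [hL, alphaF]
      rintro ⟨f, hf⟩
      obtain ⟨_, ⟨a, rfl⟩, ha⟩ := key hf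
      exact ⟨a, Subtype.ext ha⟩
    obtain ⟨R, hR⟩ : ∃ R : A ≃ₗ[k] ↥(WcF k A φ), ∀ a b, (R a).1 b = φ (b * a) :=
      ⟨LinearEquiv.ofBijective L ⟨hinj, hsurj⟩, hL⟩
    refine ⟨R, fun c => ?_, fun a => ?_, fun a b => ?_⟩
    · apply Subtype.ext
      ext b
      simp [hR, TcF, alphaF]
    · simp [ScF, hR]
    · apply Subtype.ext
      ext c
      simp [hR, piCF, GammaF, mul_assoc]
end
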